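/- Let K be a field and S = K[x_1,...,x_n] a polynomial ring. Let I ⊆ S be a monomial ideal generated in degree 2 with height g. Then there exists a monomial ideal J ⊆ S containing (x_1^2,...,x_g^2) such that the Hilbert function of S/J equals the Hilbert function of S/I. -/

import Mathlib

open MvPolynomial

/-- The height of an ideal: the infimum of heights of primes containing it. -/
noncomputable def idealHeight {R : Type*} [CommRing R] (I : Ideal R) : ℕ∞ :=
  ⨅ P : {P : PrimeSpectrum R // I ≤ P.asIdeal}, Order.height P.val

/-- The Hilbert function of the graded quotient `S/I`. -/
noncomputable def hilbertFunction (K : Type*) [Field K] {n : ℕ}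
    (I : Ideal (MvPolynomial (Fin n) K)) (d : ℕ) : ℕ :=
  Module.finrank K ((MvPolynomial.homogeneousSubmodule (Fin n) K d).map
    (Ideal.Quotient.mkₐ K I).toLinearMap)

/-- An ideal is a monomial ideal if it is generated by monomials. -/
def IsMonomialIdeal {K : Type*} [Field K] {n : ℕ} (I : Ideal (MvPolynomial (Fin n) K)) : Prop :=
  ∃ M : Set (Fin n →₀ ℕ), I = Ideal.span ((fun m => MvPolynomial.monomial m (1 : K)) '' M)

/-- A monomial ideal generated in degree 2, i.e. generated by products of two variables. -/
def IsQuadraticMonomialIdeal {K : Type*} [Field K] {n : ℕ}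
    (I : Ideal (MvPolynomial (Fin n) K)) : Prop :=
  ∃ E : Set (Fin n × Fin n), I = Ideal.span ((fun e => X e.1 * X e.2) '' E)


structure Sys where
  N : ℕ → ℕ
  G : ℕ → ℕ → ℕ

def stk (n : ℕ) (A B : ℕ → ℕ) (r : ℕ) : ℕ := A (min r n) + B (r - n)

theorem stk_le {n : ℕ} {A B : ℕ → ℕ} {r : ℕ} (h : r ≤ n) (hB : B 0 = 0) :
    stk n A B r = A r := by
  simp [stk, min_eq_left h, Nat.sub_eq_zero_of_le h, hB]

theorem stk_ge {n : ℕ} {A B : ℕ → ℕ} {r : ℕ} (h : n ≤ r) :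
    stk n A B r = A n + B (r - n) := by
  simp [stk, min_eq_right h]

def EE (nA : ℕ) (A : ℕ → ℕ) (nB : ℕ) (B : ℕ → ℕ) : Prop :=
  ∀ p ≤ nA, ∀ q ≤ nB, A p + B q ≤ stk nB B A (p + q)

structure Good (S : Sys) : Prop where
  N0 : S.N 0 = 1
  G0 : ∀ m, S.G 0 m = m * S.N 1
  Gz : ∀ d, S.G d 0 = 0
  GN : ∀ d, S.G d (S.N d) = S.N (d + 1)
  mono : ∀ d, Monotone (S.G d)
  inc : ∀ d m, S.G d (m + 1) ≤ S.G d m + S.N 1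
  ee : ∀ d e, e ≤ d → EE (S.N d) (S.G d) (S.N e) (S.G e)

structure Step (s t u : Sys) : Prop where
  N0 : s.N 0 = 1
  NS : ∀ d, s.N (d + 1) = t.N (d + 1) + u.N d
  G0 : ∀ m, s.G 0 m = m * s.N 1
  GS : ∀ d m, s.G (d + 1) m = stk (t.N (d + 1)) (t.G (d + 1)) (u.G d) m

def nilS : Sys := ⟨fun d => if d = 0 then 1 else 0, fun _ _ => 0⟩

def sqS (t : Sys) : Sys where
  N := fun d => match d with
    | 0 => 1
    | d + 1 => t.N (d + 1) + t.N d
  G := fun d m => match d with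
    | 0 => m * (t.N 1 + t.N 0)
    | d + 1 => stk (t.N (d + 1)) (t.G (d + 1)) (t.G d) m

def frN (t : Sys) : ℕ → ℕ
  | 0 => 1
  | d + 1 => t.N (d + 1) + frN t d

def frG (t : Sys) : ℕ → ℕ → ℕ
  | 0 => fun m => m * frN t 1
  | d + 1 => stk (t.N (d + 1)) (t.G (d + 1)) (frG t d)

def frS (t : Sys) : Sys := ⟨frN t, frG t⟩

theorem step_sq (t : Sys) : Step (sqS t) t t := ⟨rfl, fun _ => rfl, fun _ => rfl, fun _ _ => rfl⟩
theorem step_fr (t : Sys) : Step (frS t) t (frS t) :=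
  ⟨rfl, fun _ => rfl, fun _ => rfl, fun _ _ => rfl⟩

theorem good_nil : Good nilS where
  N0 := rfl
  G0 := fun m => by simp [nilS]
  Gz := fun d => rfl
  GN := fun d => by simp [nilS]
  mono := fun d a b h => le_rfl
  inc := fun d m => by simp [nilS]
  ee := fun d e h p hp q hq => by simp [nilS]

section
variable {s t u : Sys}

theorem Step.GS_le (h : Step s t u) (hu : ∀ d, u.G d 0 = 0) {d m : ℕ} (hm : m ≤ t.N (d + 1)) :
    s.G (d + 1) m = t.G (d + 1) m := by
  rw [h.GS, stk_le hm (hu d)]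

theorem Step.GS_add (h : Step s t u) (ht : Good t) (d m : ℕ) :
    s.G (d + 1) (t.N (d + 1) + m) = t.N (d + 1 + 1) + u.G d m := by
  rw [h.GS, stk_ge (by omega), ht.GN]; congr 2; omega

/-- basic properties, by cases on `u = t` or `u = s` -/
theorem Step.basic (h : Step s t u) (ht : Good t) (hu : u = t ∨ u = s) (d : ℕ) :
    s.G d 0 = 0 ∧ s.G d (s.N d) = s.N (d + 1) ∧ Monotone (s.G d) ∧
      ∀ m, s.G d (m + 1) ≤ s.G d m + s.N 1 := by
  have hN1 : s.N 1 = t.N 1 + u.N 0 := h.NS 0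
  have hu0 : u.N 0 = 1 := by rcases hu with rfl | rfl; exacts [ht.N0, h.N0]
  induction d with
  | zero =>
    refine ⟨by simp [h.G0], by simp [h.G0, h.N0], ?_, ?_⟩
    · intro a b hab; simp only [h.G0]; exact Nat.mul_le_mul_right _ hab
    · intro m; simp only [h.G0]; rw [Nat.add_mul]; omega
  | succ d ih =>
    have hu' : u.G d 0 = 0 ∧ u.G d (u.N d) = u.N (d + 1) ∧ Monotone (u.G d) ∧
      ∀ m, u.G d (m + 1) ≤ u.G d m + s.N 1 := by
      rcases hu with rfl | rfl
      · exact ⟨ht.Gz d, ht.GN d, ht.mono d, fun m => (ht.inc d m).trans (by omega)⟩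
      · exact ih
    obtain ⟨u1, u2, u3, u4⟩ := hu'
    refine ⟨?_, ?_, ?_, ?_⟩
    · rw [h.GS, stk_le (by omega) u1, ht.Gz]
    · rw [h.NS, h.GS_add ht, h.NS, u2]
    · intro a b hab
      rw [h.GS, h.GS]; unfold stk
      exact add_le_add (ht.mono _ (by omega)) (u3 (by omega))
    · intro m
      rcases le_or_gt (t.N (d + 1)) m with hm | hm
      · obtain ⟨k, rfl⟩ := Nat.exists_eq_add_of_le hm
        rw [add_assoc, h.GS_add ht, h.GS_add ht]; have := u4 k; omega
      · rw [h.GS, h.GS, stk_le (by omega) u1, stk_le (by omega) u1]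
        have := ht.inc (d + 1) m; omega

theorem ee_zero {n : ℕ} {A : ℕ → ℕ} (hA : A 0 = 0) (c : ℕ) (inc : ∀ m, A (m + 1) ≤ A m + c) :
    EE n A 1 (fun m => m * c) := by
  intro p hp q hq
  have hq : q = 0 ∨ q = 1 := by omega
  rcases hq with rfl | rfl
  · rcases p with _ | p
    · simp [hA, stk]
    · rw [stk_ge (by omega)]; have := inc p; simp; omega
  · rw [stk_ge (by omega)]; simp; omega

theorem Step.ee' (h : Step s t u) (ht : Good t) (hu : u = t ∨ u = s) (d e : ℕ) (hed : e ≤ d) :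
    EE (t.N d) (t.G d) (s.N e) (s.G e) := by
  have hN1 : s.N 1 = t.N 1 + u.N 0 := h.NS 0
  induction e with
  | zero =>
    have e1 : s.G 0 = fun m => m * s.N 1 := funext h.G0
    rw [h.N0, e1]
    exact ee_zero (ht.Gz d) _ (fun m => (ht.inc d m).trans (by omega))
  | succ e ih =>
    have ii : EE (t.N d) (t.G d) (u.N e) (u.G e) := by
      rcases hu with rfl | rfl
      · exact ht.ee d e (by omega)
      · exact ih (by omega)
    have uz : ∀ d, u.G d 0 = 0 := by
      rcases hu with rfl | rfl
      · exact ht.Gz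
      · exact fun d => (h.basic ht (Or.inr rfl) d).1
    have un : u.G e (u.N e) = u.N (e + 1) := by
      rcases hu with rfl | rfl
      · exact ht.GN e
      · exact (h.basic ht (Or.inr rfl) e).2.1
    have sn := (h.basic ht hu (e + 1)).2.1
    have sN := h.NS e
    have sN2 := h.NS (e + 1)
    -- target simplification
    have tgt : ∀ r, stk (s.N (e + 1)) (s.G (e + 1)) (t.G d) (t.N (e + 1) + r)
        = t.N (e + 1 + 1) + stk (u.N e) (u.G e) (t.G d) r := by
      intro r
      rcases le_total r (u.N e) with hr | hr
      · rw [stk_le (by omega) (ht.Gz d), stk_le hr (ht.Gz d), h.GS_add ht]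
      · rw [stk_ge (by omega), stk_ge hr, sn, un, sN2,
          show t.N (e + 1) + r - s.N (e + 1) = r - u.N e by omega]; omega
    intro p hp q hq
    rcases le_total q (t.N (e + 1)) with hq' | hq'
    · rw [h.GS_le uz hq']
      have h1 := ht.ee d (e + 1) hed p hp q hq'
      refine h1.trans ?_
      rcases le_total (p + q) (t.N (e + 1)) with hr | hr
      · rw [stk_le hr (ht.Gz d), stk_le (by omega) (ht.Gz d), h.GS_le uz hr]
      · obtain ⟨r, hr⟩ := Nat.exists_eq_add_of_le hr
        rw [hr, tgt, stk_ge (by omega), ht.GN]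
        have := ii r (by omega) 0 (by omega)
        rw [uz] at this
        simp at this ⊢; exact this
    · obtain ⟨k, rfl⟩ := Nat.exists_eq_add_of_le hq'
      rw [h.GS_add ht, show p + (t.N (e + 1) + k) = t.N (e + 1) + (p + k) by omega, tgt]
      have := ii p hp k (by omega)
      omega

theorem Step.good (h : Step s t u) (ht : Good t) (hu : u = t ∨ u = s) : Good s := by
  have B := h.basic ht hu
  have sz := fun d => (B d).1
  have sn := fun d => (B d).2.1
  have E' := h.ee' ht hu
  have uz : ∀ d, u.G d 0 = 0 := by
    rcases hu with rfl | rfl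
    exacts [ht.Gz, sz]
  have un : ∀ d, u.G d (u.N d) = u.N (d + 1) := by
    rcases hu with rfl | rfl
    exacts [ht.GN, sn]
  refine ⟨h.N0, h.G0, sz, sn, fun d => (B d).2.2.1, fun d => (B d).2.2.2, ?_⟩
  intro d
  induction d with
  | zero =>
    intro e he
    obtain rfl : e = 0 := by omega
    have e1 : s.G 0 = fun m => m * s.N 1 := funext h.G0
    rw [h.N0, e1]
    exact ee_zero (by simp) _ (fun m => by simp [Nat.add_mul])
  | succ d ih =>
    have iii : ∀ e, e ≤ d → EE (u.N d) (u.G d) (s.N e) (s.G e) := by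
      intro e he
      rcases hu with rfl | rfl
      · exact E' d e he
      · exact ih e he
    have iv : EE (u.N d) (u.G d) (u.N d) (u.G d) := by
      rcases hu with rfl | rfl
      · exact ht.ee d d le_rfl
      · exact ih d le_rfl
    have sN := h.NS d
    -- from E' to goal, for small p
    have small : ∀ e, e ≤ d + 1 → ∀ p ≤ t.N (d + 1), ∀ q ≤ s.N e,
        t.G (d + 1) p + s.G e q ≤ stk (s.N e) (s.G e) (s.G (d + 1)) (p + q) := by
      intro e he p hp q hq
      have h1 := E' (d + 1) e he p hp q hq
      refine h1.trans ?_
      unfold stk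
      rw [h.GS_le uz (show p + q - s.N e ≤ t.N (d + 1) by omega)]
    intro e he p hp q hq
    rcases le_total p (t.N (d + 1)) with hp' | hp'
    · rw [h.GS_le uz hp']; exact small e he p hp' q hq
    obtain ⟨p', rfl⟩ := Nat.exists_eq_add_of_le hp'
    rw [h.GS_add ht]
    rcases Nat.lt_or_ge d e with hde | hde
    · obtain rfl : e = d + 1 := by omega
      rcases le_total q (t.N (d + 1)) with hq' | hq'
      · have := small (d + 1) le_rfl q hq' (t.N (d + 1) + p') hp
        rw [h.GS_le uz hq', add_comm (t.N (d + 1) + p') q]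
        rw [h.GS_add ht] at this; omega
      obtain ⟨q', rfl⟩ := Nat.exists_eq_add_of_le hq'
      rw [h.GS_add ht]
      have h1 := iv p' (by omega) q' (by omega)
      rcases le_total (p' + q') (u.N d) with hr | hr
      · rw [stk_le hr (uz d)] at h1
        have h2 := small (d + 1) le_rfl (t.N (d + 1)) le_rfl (t.N (d + 1) + (p' + q')) (by omega)
        rw [h.GS_add ht, ht.GN] at h2
        rw [show t.N (d + 1) + p' + (t.N (d + 1) + q') = t.N (d + 1) + (t.N (d + 1) + (p' + q')) by omega]
        omega
      · rw [stk_ge hr, un] at h1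
        rw [stk_ge (by omega), sn, h.NS (d + 1), show t.N (d + 1) + p' + (t.N (d + 1) + q') - s.N (d + 1)
          = t.N (d + 1) + (p' + q' - u.N d) by omega, h.GS_add ht]
        omega
    · have h1 := iii e hde p' (by omega) q hq
      rcases le_total (p' + q) (s.N e) with hr | hr
      · rw [stk_le hr (uz d)] at h1
        have h2 := small e he (t.N (d + 1)) le_rfl (p' + q) hr
        rw [ht.GN] at h2
        rw [show t.N (d + 1) + p' + q = t.N (d + 1) + (p' + q) by omega]
        omega
      · rw [stk_ge hr, sn] at h1
        rw [stk_ge (by omega), sn, show t.N (d + 1) + p' + q - s.N e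
          = t.N (d + 1) + (p' + q - s.N e) by omega, h.GS_add ht]
        omega

end

/-- the two-layer inequality -/
def KK (S : Sys) : Prop := ∀ d, ∀ p ≤ S.N (d + 1), ∀ q ≤ S.N d,
  S.G (d + 1) p + min p (S.G d q) ≤ stk (S.N (d + 1)) (S.G (d + 1)) (S.G d) (p + q)

def KP (S : Sys) : Prop := ∀ d, ∀ p ≤ S.N (d + 1), ∀ q ≤ S.N d,
  S.G (d + 1) p + min (p + q) (S.G d q) ≤ stk (S.N (d + 1)) (S.G (d + 1)) (S.G d) (p + q)

theorem KP.KK {S : Sys} (h : KP S) : KK S := fun d p hp q hq =>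
  le_trans (by have : min p (S.G d q) ≤ min (p + q) (S.G d q) := by omega
               omega) (h d p hp q hq)

theorem KK_sq {t : Sys} (ht : Good t) (hK : KK t) : KK (sqS t) := by
  have h := step_sq t
  have hs := h.good ht (Or.inl rfl)
  set s := sqS t
  intro d p hp q hq
  rcases d with _ | d
  · rw [h.N0] at hq
    have hN1 : s.N 1 = t.N 1 + t.N 0 := h.NS 0
    have gs1 : ∀ p ≤ t.N 1, s.G 1 p = t.G 1 p := fun p hp => h.GS_le ht.Gz hp
    have gs2 : s.G 1 (t.N 1 + 1) = t.N 2 + t.G 0 1 := h.GS_add ht 0 1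
    have gn1 := ht.GN 1
    have gn2 := hs.GN 1
    rw [ht.N0] at hN1
    simp only [Nat.zero_add] at *
    have hq : q = 0 ∨ q = 1 := by omega
    rcases hq with rfl | rfl
    · rw [hs.Gz, stk_le (by simpa using hp) (hs.Gz _)]; simp
    · rw [hs.G0]
      rcases Nat.lt_or_ge p (s.N 1) with hlt | hge
      · rw [stk_le (by omega) (hs.Gz _), gs1 p (by omega)]
        have h1 := hK 0 p (by simp only [Nat.zero_add]; omega) 1 (by rw [ht.N0])
        simp only [Nat.zero_add] at h1
        rw [ht.G0] at h1
        rcases Nat.lt_or_ge p (t.N 1) with hlt' | hge'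
        · rw [stk_le (by omega) (ht.Gz _)] at h1
          rw [gs1 _ (by omega)]
          omega
        · obtain rfl : p = t.N 1 := by omega
          rw [gs2, ht.G0]
          simp only [Nat.reduceAdd] at *
          omega
      · obtain rfl : p = s.N 1 := by omega
        rw [stk_ge (by omega)]
        simp [hs.G0]
  · have sN := h.NS d
    have sN1 := h.NS (d + 1)
    rcases le_total p (t.N (d + 1 + 1)) with hp' | hp'
    · -- reduce to q ≤ t.N (d+1)
      have main : ∀ q ≤ t.N (d + 1), t.G (d + 1 + 1) p + min p (t.G (d + 1) q) ≤
          stk (s.N (d + 1 + 1)) (s.G (d + 1 + 1)) (s.G (d + 1)) (p + q) := by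
        intro q hq
        refine (hK (d + 1) p hp' q hq).trans ?_
        rw [stk_le (n := s.N (d + 1 + 1)) (by omega) (hs.Gz _), h.GS]
      rw [h.GS_le ht.Gz hp']
      rcases le_total q (t.N (d + 1)) with hq' | hq'
      · rw [h.GS_le ht.Gz hq']; exact main q hq'
      · have h1 := main _ le_rfl
        rw [ht.GN] at h1
        have h2 : stk (s.N (d + 1 + 1)) (s.G (d + 1 + 1)) (s.G (d + 1)) (p + t.N (d + 1)) ≤
          stk (s.N (d + 1 + 1)) (s.G (d + 1 + 1)) (s.G (d + 1)) (p + q) := by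
          unfold stk
          exact add_le_add (hs.mono _ (by omega)) (hs.mono _ (by omega))
        have : min p (s.G (d + 1) q) ≤ min p (t.N (d + 1 + 1)) := by omega
        omega
    · obtain ⟨p', rfl⟩ := Nat.exists_eq_add_of_le hp'
      have e1 := h.GS_add ht (d + 1) p'
      rw [e1]
      rcases le_total q (t.N (d + 1)) with hq' | hq'
      · rw [h.GS_le ht.Gz hq']
        have h1 := ht.ee (d + 1) (d + 1) le_rfl p' (by omega) q hq'
        rcases le_total (p' + q) (t.N (d + 1)) with hr | hr
        · rw [stk_le hr (ht.Gz _)] at h1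
          rw [stk_le (by omega) (hs.Gz _), show t.N (d + 1 + 1) + p' + q = t.N (d + 1 + 1) + (p' + q) by omega]
          have e2 := h.GS_add ht (d + 1) (p' + q)
          omega
        · rw [stk_ge hr, ht.GN] at h1
          rw [stk_ge (by omega), hs.GN, h.GS_le ht.Gz (by omega), h.NS (d + 1 + 1),
            show t.N (d + 1 + 1) + p' + q - s.N (d + 1 + 1) = p' + q - t.N (d + 1) by omega]
          omega
      · obtain ⟨q', rfl⟩ := Nat.exists_eq_add_of_le hq'
        have h1 := hK d p' (by omega) q' (by omega)
        rw [h.GS_add ht]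
        rw [stk_ge (by omega), hs.GN, h.NS (d + 1 + 1),
            show t.N (d + 1 + 1) + p' + (t.N (d + 1) + q') - s.N (d + 1 + 1) = p' + q' by omega, h.GS]
        omega

/-- increments at least one -/
def P1 (S : Sys) : Prop := ∀ d m, m < S.N (d + 1) → S.G (d + 1) m + 1 ≤ S.G (d + 1) (m + 1)

theorem P1_fr0 {t : Sys} (ht : Good t) (h1 : P1 t) (d m : ℕ) (hm : m < (frS t).N d) :
    (frS t).G d m + 1 ≤ (frS t).G d (m + 1) := by
  have h := step_fr t
  have hs := h.good ht (Or.inr rfl)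
  set s := frS t
  induction d generalizing m with
  | zero =>
    have hN1 : s.N 1 = t.N 1 + s.N 0 := h.NS 0
    rw [hs.N0] at hN1
    rw [hs.G0, hs.G0, Nat.add_mul]; omega
  | succ d ih =>
    have sN := h.NS d
    rcases Nat.lt_or_ge m (t.N (d + 1)) with hlt | hge
    · rw [h.GS_le hs.Gz hlt.le, h.GS_le hs.Gz (show m + 1 ≤ _ from hlt)]
      exact h1 d m hlt
    · obtain ⟨k, rfl⟩ := Nat.exists_eq_add_of_le hge
      rw [add_assoc, h.GS_add ht, h.GS_add ht]
      have := ih k (by omega)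
      omega

theorem P1_add {A : ℕ → ℕ} {n : ℕ} (h : ∀ m < n, A m + 1 ≤ A (m + 1)) (k m : ℕ) (hm : m + k ≤ n) :
    A m + k ≤ A (m + k) := by
  induction k with
  | zero => simp
  | succ k ih =>
    have := ih (by omega)
    have := h (m + k) (by omega)
    rw [show m + (k + 1) = m + k + 1 by omega]; omega

theorem KP_fr {t : Sys} (ht : Good t) (hK : KP t) (h1 : P1 t) : KP (frS t) := by
  have h := step_fr t
  have hs := h.good ht (Or.inr rfl)
  have hP := P1_fr0 ht h1
  set s := frS t
  intro d
  induction d with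
  | zero =>
    intro p hp q hq
    rw [h.N0] at hq
    have hN1 : s.N 1 = t.N 1 + s.N 0 := h.NS 0
    have gs1 : ∀ p ≤ t.N 1, s.G 1 p = t.G 1 p := fun p hp => h.GS_le hs.Gz hp
    have gs2 : s.G 1 (t.N 1 + 1) = t.N 2 + s.G 0 1 := h.GS_add ht 0 1
    have gn1 := ht.GN 1
    have gn2 := hs.GN 1
    rw [hs.N0] at hN1
    simp only [Nat.zero_add] at *
    have hq : q = 0 ∨ q = 1 := by omega
    rcases hq with rfl | rfl
    · rw [hs.Gz, stk_le (by simpa using hp) (hs.Gz _)]; simp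
    · rw [hs.G0]
      rcases Nat.lt_or_ge p (s.N 1) with hlt | hge
      · rw [stk_le (by omega) (hs.Gz _), gs1 p (by omega)]
        have h1 := hK 0 p (by simp only [Nat.zero_add]; omega) 1 (by rw [ht.N0])
        simp only [Nat.zero_add] at h1
        rw [ht.G0] at h1
        rcases Nat.lt_or_ge p (t.N 1) with hlt' | hge'
        · rw [stk_le (by omega) (ht.Gz _)] at h1
          rw [gs1 _ (by omega)]
          omega
        · obtain rfl : p = t.N 1 := by omega
          rw [gs2, hs.G0]
          simp only [Nat.reduceAdd] at *
          omega
      · obtain rfl : p = s.N 1 := by omega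
        rw [stk_ge (by omega)]
        simp [hs.G0]
  | succ d ih =>
    intro p hp q hq
    have sN := h.NS d
    have sN1 := h.NS (d + 1)
    rcases le_total p (t.N (d + 1 + 1)) with hp' | hp'
    · rw [h.GS_le hs.Gz hp', stk_le (by omega) (hs.Gz _)]
      rcases le_total q (t.N (d + 1)) with hq' | hq'
      · rw [h.GS_le hs.Gz hq']
        refine (hK (d + 1) p hp' q hq').trans ?_
        rw [h.GS]
        unfold stk
        rw [h.GS_le hs.Gz (show p + q - t.N (d + 1 + 1) ≤ _ by omega)]
      · obtain ⟨q', rfl⟩ := Nat.exists_eq_add_of_le hq'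
        rw [h.GS_add ht]
        have k1 := hK (d + 1) p hp' (t.N (d + 1)) le_rfl
        rw [ht.GN] at k1
        rcases le_total (p + t.N (d + 1)) (t.N (d + 1 + 1)) with hr | hr
        · rw [stk_le hr (ht.Gz _), min_eq_left hr] at k1
          rcases le_total (p + (t.N (d + 1) + q')) (t.N (d + 1 + 1)) with hr' | hr'
          · rw [h.GS_le hs.Gz hr']
            have := P1_add (h1 (d + 1)) q' (p + t.N (d + 1)) (by omega)
            rw [add_assoc p] at this
            omega
          · obtain ⟨r, hr2⟩ := Nat.exists_eq_add_of_le hr'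
            rw [hr2, h.GS_add ht]
            have a1 := P1_add (h1 (d + 1)) (t.N (d + 1 + 1) - (p + t.N (d + 1))) (p + t.N (d + 1)) (by omega)
            rw [show p + t.N (d + 1) + (t.N (d + 1 + 1) - (p + t.N (d + 1))) = t.N (d + 1 + 1) by omega,
              ht.GN] at a1
            have a2 := P1_add (hP (d + 1)) r 0 (by omega)
            rw [hs.Gz, zero_add] at a2
            omega
        · obtain ⟨v, hv⟩ := Nat.exists_eq_add_of_le hr
          rw [hv, stk_ge (by omega), ht.GN, min_eq_right (by omega), Nat.add_sub_cancel_left] at k1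
          rw [show p + (t.N (d + 1) + q') = t.N (d + 1 + 1) + (v + q') by omega, h.GS_add ht]
          have k2 := ih v (by omega) q' (by omega)
          rw [stk_le (by omega) (hs.Gz _), h.GS_le hs.Gz (show v ≤ _ by omega)] at k2
          omega
    · obtain ⟨p', rfl⟩ := Nat.exists_eq_add_of_le hp'
      rw [h.GS_add ht]
      have tgt : stk (s.N (d + 1 + 1)) (s.G (d + 1 + 1)) (s.G (d + 1)) (t.N (d + 1 + 1) + p' + q) =
          t.N (d + 1 + 1 + 1) + stk (s.N (d + 1)) (s.G (d + 1)) (s.G (d + 1)) (p' + q) := by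
        rcases le_total (p' + q) (s.N (d + 1)) with hr | hr
        · rw [stk_le hr (hs.Gz _), stk_le (by omega) (hs.Gz _), add_assoc (t.N (d + 1 + 1)), h.GS_add ht]
        · rw [stk_ge hr, stk_ge (by omega), hs.GN, hs.GN, h.NS (d + 1 + 1),
            show t.N (d + 1 + 1) + p' + q - s.N (d + 1 + 1) = p' + q - s.N (d + 1) by omega]
          omega
      have e1 := hs.ee (d + 1) (d + 1) le_rfl p' (by omega) q (by omega)
      rw [tgt]
      omega

theorem P1_nil : P1 nilS := fun d m hm => by simp [nilS] at hm
theorem KP_nil : KP nilS := fun d p hp q hq => by simp [nilS, stk]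

/-- `b` free variables -/
def FR : ℕ → Sys
  | 0 => nilS
  | b + 1 => frS (FR b)

theorem FR_all (b : ℕ) : Good (FR b) ∧ KP (FR b) ∧ P1 (FR b) := by
  induction b with
  | zero => exact ⟨good_nil, KP_nil, P1_nil⟩
  | succ b ih =>
    obtain ⟨h1, h2, h3⟩ := ih
    exact ⟨(step_fr _).good h1 (Or.inr rfl), KP_fr h1 h2 h3, fun d m hm => P1_fr0 h1 h3 _ _ hm⟩

/-- `a` square-zero and `b` free variables -/
def SF (b : ℕ) : ℕ → Sys
  | 0 => FR b
  | a + 1 => sqS (SF b a)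

theorem SF_all (b a : ℕ) : Good (SF b a) ∧ KK (SF b a) := by
  induction a with
  | zero => exact ⟨(FR_all b).1, (FR_all b).2.1.KK⟩
  | succ a ih => exact ⟨(step_sq _).good ih.1 (Or.inl rfl), KK_sq ih.1 ih.2⟩

theorem cover_bound {K : Type*} [Field K] {n g : ℕ} (E : Set (Fin n × Fin n))
    (hht : idealHeight (Ideal.span ((fun e => (X e.1 * X e.2 : MvPolynomial (Fin n) K)) '' E)) = (g : ℕ∞))
    (C : Finset (Fin n)) (hC : ∀ e ∈ E, e.1 ∈ C ∨ e.2 ∈ C) : g ≤ C.card := by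
  classical
  set I := Ideal.span ((fun e => (X e.1 * X e.2 : MvPolynomial (Fin n) K)) '' E)
  set P : Ideal (MvPolynomial (Fin n) K) := Ideal.span (X '' (C : Set (Fin n)))
  have hIP : I ≤ P := by
    rw [Ideal.span_le]
    rintro _ ⟨e, he, rfl⟩
    rcases hC e he with h | h
    · exact Ideal.mul_mem_right _ _ (Ideal.subset_span ⟨_, h, rfl⟩)
    · exact Ideal.mul_mem_left _ _ (Ideal.subset_span ⟨_, h, rfl⟩)
  have hPtop : P ≠ ⊤ := by
    rw [Ideal.ne_top_iff_one, mem_ideal_span_X_image]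
    push Not
    refine ⟨0, by simp, by simp⟩
  obtain ⟨p, hp⟩ := Ideal.nonempty_minimalPrimes hPtop
  have hprime : p.IsPrime := hp.1.1
  have h1 : (g : ℕ∞) ≤ p.height := by
    rw [← hht, PrimeSpectrum.height_eq_orderHeight ⟨p, hprime⟩]
    exact iInf_le (fun Q : {Q : PrimeSpectrum (MvPolynomial (Fin n) K) // I ≤ Q.asIdeal} => Order.height Q.val)
      ⟨⟨p, hprime⟩, hIP.trans hp.1.2⟩
  have h2 := Ideal.height_le_card_of_mem_minimalPrimes_span (C.finite_toSet.image _) hp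
  have h3 : (X '' (C : Set (Fin n)) : Set (MvPolynomial (Fin n) K)).ncard ≤ C.card := by
    refine (Set.ncard_image_le C.finite_toSet).trans ?_
    simp
  have h4 := h1.trans h2
  have h5 : g ≤ (X '' (C : Set (Fin n)) : Set (MvPolynomial (Fin n) K)).ncard := by exact_mod_cast h4
  exact h5.trans h3

theorem deg_finite {ι : Type*} [Finite ι] (d : ℕ) : {u : ι →₀ ℕ | u.degree = d}.Finite := by
  classical
  refine (Set.finite_Icc 0 (Finsupp.equivFunOnFinite.symm (fun _ => d) : ι →₀ ℕ)).subset ?_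
  intro u hu
  refine ⟨zero_le, fun i => ?_⟩
  have := Finsupp.le_degree i u
  change u.degree = d at hu
  change u i ≤ d
  omega

theorem hilb_eq {K : Type*} [Field K] {n : ℕ} (M : Set (Fin n →₀ ℕ)) (d : ℕ) :
    hilbertFunction K (Ideal.span ((fun m => monomial m (1 : K)) '' M)) d =
      {u : Fin n →₀ ℕ | (∀ m ∈ M, ¬ m ≤ u) ∧ u.degree = d}.ncard := by
  classical
  set I := Ideal.span ((fun m => monomial m (1 : K)) '' M)
  set T := {u : Fin n →₀ ℕ | (∀ m ∈ M, ¬ m ≤ u) ∧ u.degree = d} with hT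
  have hfin : T.Finite := (deg_finite d).subset fun u hu => hu.2
  have : Fintype T := hfin.fintype
  let f := (Ideal.Quotient.mkₐ K I).toLinearMap
  let v : T → MvPolynomial (Fin n) K := fun u => monomial u.1 1
  have hker : ∀ p, f p = 0 ↔ p ∈ I := fun p => by
    simp [f, Ideal.Quotient.eq_zero_iff_mem]
  have hli : LinearIndependent K v := by
    have := (basisMonomials (Fin n) K).linearIndependent
    have hv : v = basisMonomials (Fin n) K ∘ (fun u : T => u.1) := by
      funext u; simp [v]
    rw [hv]
    exact this.comp (fun u : T => u.1) Subtype.val_injective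
  have hsp : ∀ p ∈ Submodule.span K (Set.range v), ∀ u ∈ p.support, u ∈ T := by
    intro p hp
    induction hp using Submodule.span_induction with
    | mem x hx =>
      obtain ⟨u, rfl⟩ := hx
      intro w hw
      have := support_monomial_subset hw
      simp at this
      rw [this]; exact u.2
    | zero => simp
    | add x y _ _ hx hy =>
      intro u hu
      rcases Finset.mem_union.1 (support_add hu) with h | h
      · exact hx u h
      · exact hy u h
    | smul a x _ hx =>
      intro u hu
      exact hx u (support_smul hu)
  have hli2 : LinearIndependent K (f ∘ v) := by
    refine hli.map ?_
    rw [Submodule.disjoint_def]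
    intro p hp hp2
    rw [LinearMap.mem_ker, hker, mem_ideal_span_monomial_image] at hp2
    by_contra hne
    obtain ⟨u, hu⟩ := Finset.nonempty_iff_ne_empty.2 (mt support_eq_empty.1 hne)
    obtain ⟨m, hm, hmu⟩ := hp2 u hu
    exact (hsp p hp u hu).1 m hm hmu
  have hmap : (homogeneousSubmodule (Fin n) K d).map f = Submodule.span K (Set.range (f ∘ v)) := by
    apply le_antisymm
    · rw [Submodule.map_le_iff_le_comap]
      intro p hp
      rw [Submodule.mem_comap, p.as_sum, map_sum]
      refine Submodule.sum_mem _ fun u hu => ?_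
      have hdu : u.degree = d := by
        have := hp (mem_support_iff.1 hu)
        rw [Finsupp.degree_eq_weight_one]; exact this
      have e1 : monomial u (coeff u p) = coeff u p • monomial u (1 : K) := by
        simp [smul_monomial]
      rw [e1, map_smul]
      refine Submodule.smul_mem _ _ ?_
      by_cases h : ∀ m ∈ M, ¬ m ≤ u
      · exact Submodule.subset_span ⟨⟨u, h, hdu⟩, rfl⟩
      · push Not at h
        have : f (monomial u 1) = 0 := by
          rw [hker, mem_ideal_span_monomial_image]
          intro w hw
          have := support_monomial_subset hw
          simp at this
          rw [this]; exact h
        rw [this]; exact Submodule.zero_mem _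
    · rw [Submodule.span_le]
      rintro _ ⟨u, rfl⟩
      refine ⟨v u, ?_, rfl⟩
      exact isHomogeneous_monomial _ u.2.2
  unfold hilbertFunction
  change Module.finrank K ((homogeneousSubmodule (Fin n) K d).map f) = _
  rw [hmap, finrank_span_eq_card hli2, Set.ncard_eq_toFinset_card', Set.toFinset_card]

section
variable {ι : Type*} [Finite ι]

noncomputable def cnt (Q : Set (ι →₀ ℕ)) (d : ℕ) : ℕ := {u : ι →₀ ℕ | u ∈ Q ∧ u.degree = d}.ncard

def del (x : ι) (Q : Set (ι →₀ ℕ)) : Set (ι →₀ ℕ) := {u | u ∈ Q ∧ u x = 0}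

noncomputable def lnk (x : ι) (Q : Set (ι →₀ ℕ)) : Set (ι →₀ ℕ) := {u | u + Finsupp.single x 1 ∈ Q}

theorem cnt_fin (Q : Set (ι →₀ ℕ)) (d : ℕ) : {u : ι →₀ ℕ | u ∈ Q ∧ u.degree = d}.Finite :=
  (deg_finite d).subset fun _ hu => hu.2

theorem cnt_mono {Q R : Set (ι →₀ ℕ)} (h : Q ⊆ R) (d : ℕ) : cnt Q d ≤ cnt R d :=
  Set.ncard_le_ncard (fun _ hu => ⟨h hu.1, hu.2⟩) (cnt_fin R d)

theorem cnt_zero_le (Q : Set (ι →₀ ℕ)) : cnt Q 0 ≤ 1 := by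
  have : {u : ι →₀ ℕ | u ∈ Q ∧ u.degree = 0} ⊆ {0} := by
    rintro u ⟨_, hu⟩
    exact (Finsupp.degree_eq_zero_iff u).1 hu
  exact (Set.ncard_le_ncard this).trans (by simp)

theorem cnt_empty (d : ℕ) : cnt (∅ : Set (ι →₀ ℕ)) d = 0 := by
  simp [cnt]

theorem cnt_zero_eq {Q : Set (ι →₀ ℕ)} (hQ : IsLowerSet Q) (h : cnt Q 0 = 0) : Q = ∅ := by
  by_contra hne
  obtain ⟨u, hu⟩ := Set.nonempty_iff_ne_empty.2 hne
  have h0 : (0 : ι →₀ ℕ) ∈ Q := hQ (zero_le) hu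
  rw [cnt, Set.ncard_eq_zero (cnt_fin Q 0)] at h
  have : (0 : ι →₀ ℕ) ∈ {u : ι →₀ ℕ | u ∈ Q ∧ u.degree = 0} := ⟨h0, by simp⟩
  rw [h] at this
  exact this

theorem cnt_succ (Q : Set (ι →₀ ℕ)) (x : ι) (d : ℕ) :
    cnt Q (d + 1) = cnt (del x Q) (d + 1) + cnt (lnk x Q) d := by
  have hinj : Function.Injective (fun u : ι →₀ ℕ => u + Finsupp.single x 1) :=
    fun a b h => add_right_cancel h
  have e : {u : ι →₀ ℕ | u ∈ Q ∧ u.degree = d + 1} =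
      {u : ι →₀ ℕ | u ∈ del x Q ∧ u.degree = d + 1} ∪
      (fun u : ι →₀ ℕ => u + Finsupp.single x 1) '' {u : ι →₀ ℕ | u ∈ lnk x Q ∧ u.degree = d} := by
    ext u
    constructor
    · rintro ⟨h1, h2⟩
      by_cases hx : u x = 0
      · exact Or.inl ⟨⟨h1, hx⟩, h2⟩
      · have e : u - Finsupp.single x 1 + Finsupp.single x 1 = u :=
          tsub_add_cancel_of_le (by simpa [Finsupp.single_le_iff] using Nat.one_le_iff_ne_zero.2 hx)
        refine Or.inr ⟨u - Finsupp.single x 1, ⟨?_, ?_⟩, e⟩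
        · change _ ∈ Q
          rwa [e]
        · have := congrArg Finsupp.degree e
          rw [map_add, Finsupp.degree_single] at this
          omega
    · rintro (⟨h1, h2⟩ | ⟨w, ⟨h1, h2⟩, rfl⟩)
      · exact ⟨h1.1, h2⟩
      · refine ⟨h1, ?_⟩
        simp [h2]
  unfold cnt
  rw [e, Set.ncard_union_eq _ (cnt_fin _ _) ((cnt_fin _ _).image _), Set.ncard_image_of_injective _ hinj]
  rw [Set.disjoint_left]
  rintro u ⟨⟨_, h1⟩, _⟩ ⟨w, _, rfl⟩
  simp at h1

theorem lnk_sub {Q : Set (ι →₀ ℕ)} (hQ : IsLowerSet Q) (x : ι) : lnk x Q ⊆ Q :=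
  fun u hu => hQ (le_self_add) (show u + Finsupp.single x 1 ∈ Q from hu)

theorem lnk_lower {Q : Set (ι →₀ ℕ)} (hQ : IsLowerSet Q) (x : ι) : IsLowerSet (lnk x Q) :=
  fun _ _ hab ha => hQ (add_le_add_left hab _) ha

theorem del_lower {Q : Set (ι →₀ ℕ)} (hQ : IsLowerSet Q) (x : ι) : IsLowerSet (del x Q) :=
  fun a b hab ha => ⟨hQ hab ha.1, by have h1 := hab x; have h2 := ha.2; omega⟩

/-- the growth bound in degree `d` -/
def Gr (s : Sys) (Q : Set (ι →₀ ℕ)) (d : ℕ) : Prop :=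
  cnt Q d ≤ s.N d ∧ cnt Q (d + 1) ≤ s.G d (cnt Q d)

theorem Gr_zero {s : Sys} (hs : Good s) {Q : Set (ι →₀ ℕ)} (hQ : IsLowerSet Q)
    (h : cnt Q 1 ≤ s.N 1) : Gr s Q 0 := by
  refine ⟨by rw [hs.N0]; exact cnt_zero_le Q, ?_⟩
  rw [hs.G0]
  have h0 := cnt_zero_le Q
  have : cnt Q 0 = 0 ∨ cnt Q 0 = 1 := by omega
  rcases this with h1 | h1
  · rw [cnt_zero_eq hQ h1, cnt_empty, cnt_empty]; simp
  · rw [h1, one_mul]; exact h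

theorem growth_free (b : ℕ) : ∀ (W : Finset ι) (Q : Set (ι →₀ ℕ)), W.card = b → IsLowerSet Q →
    (∀ u ∈ Q, ∀ i ∉ W, u i = 0) → ∀ d, Gr (FR b) Q d := by
  classical
  induction b with
  | zero =>
    intro W Q hW hQ hs d
    have hW : W = ∅ := Finset.card_eq_zero.1 hW
    subst hW
    have hz : ∀ d, cnt Q (d + 1) = 0 := by
      intro d
      rw [cnt, Set.ncard_eq_zero (cnt_fin _ _)]
      ext u
      constructor
      · rintro ⟨h1, h2⟩
        have : u = 0 := by ext i; exact hs u h1 i (by simp)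
        subst this
        simp at h2
      · intro h; exact h.elim
    rcases d with _ | d
    · exact Gr_zero good_nil hQ (by rw [hz 0]; exact Nat.zero_le _)
    · exact ⟨by rw [hz]; exact Nat.zero_le _, by rw [hz]; exact Nat.zero_le _⟩
  | succ b ih =>
    obtain ⟨ht, -, -⟩ := FR_all b
    obtain ⟨hs, hKP, -⟩ := FR_all (b + 1)
    have h : Step (FR (b + 1)) (FR b) (FR (b + 1)) := step_fr (FR b)
    set t := FR b
    set s := FR (b + 1)
    intro W Q hW hQ hsup d
    obtain ⟨x, hx⟩ : W.Nonempty := Finset.card_pos.1 (by omega)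
    have IH0 : ∀ Q : Set (ι →₀ ℕ), IsLowerSet Q → (∀ u ∈ Q, ∀ i ∉ W, u i = 0) →
        ∀ d, Gr t (del x Q) d := by
      intro Q hQ hsup
      refine ih (W.erase x) (del x Q) (by rw [Finset.card_erase_of_mem hx]; omega) (del_lower hQ x) ?_
      intro u hu i hi
      by_cases hix : i = x
      · rw [hix]; exact hu.2
      · exact hsup u hu.1 i (fun hiW => hi (Finset.mem_erase.2 ⟨hix, hiW⟩))
    induction d generalizing Q with
    | zero =>
      refine Gr_zero hs hQ ?_
      have h1 := cnt_succ Q x 0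
      have h2 := (IH0 Q hQ hsup 1).1
      have h3 := cnt_zero_le (lnk x Q)
      have h4 := h.NS 0
      have h5 := hs.N0
      simp only [Nat.zero_add] at *
      omega
    | succ d ihd =>
      obtain ⟨i1, i2⟩ := ihd (lnk x Q) (lnk_lower hQ x) (fun u hu => hsup u (lnk_sub hQ x hu))
      obtain ⟨j1, j2⟩ := IH0 Q hQ hsup (d + 1)
      have c1 := cnt_succ Q x d
      have c2 := cnt_succ Q x (d + 1)
      have c3 := cnt_mono (lnk_sub hQ x) (d + 1)
      have hN := h.NS d
      refine ⟨by omega, ?_⟩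
      have k := hKP d (cnt (del x Q) (d + 1)) (by omega) (cnt (lnk x Q) d) i1
      rw [stk_le (by omega) (hs.Gz _), h.GS_le hs.Gz j1] at k
      rw [c1, c2]
      omega

structure Adm (E : Set (ι × ι)) (W : Finset ι) (a : ℕ) (Q : Set (ι →₀ ℕ)) : Prop where
  lower : IsLowerSet Q
  supp : ∀ u ∈ Q, ∀ i ∉ W, u i = 0
  edge : ∀ e ∈ E, Finsupp.single e.1 1 + Finsupp.single e.2 1 ∉ Q
  cov : ∀ C ⊆ W, (∀ e ∈ E, e.1 ∈ W → e.2 ∈ W → e.1 ∈ C ∨ e.2 ∈ C) → a ≤ C.card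

theorem Adm.sub [DecidableEq ι] {E : Set (ι × ι)} {W : Finset ι} {a : ℕ} {Q R : Set (ι →₀ ℕ)}
    (h : Adm E W (a + 1) Q) (x : ι) (hx : x ∈ W) (hR : R ⊆ Q) (hl : IsLowerSet R)
    (h0 : ∀ u ∈ R, u x = 0) : Adm E (W.erase x) a R where
  lower := hl
  supp := by
    intro u hu i hi
    by_cases hix : i = x
    · rw [hix]; exact h0 u hu
    · exact h.supp u (hR hu) i (fun hiW => hi (Finset.mem_erase.2 ⟨hix, hiW⟩))
  edge := fun e he hm => h.edge e he (hR hm)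
  cov := by
    intro C hC hcov
    have := h.cov (insert x C) (by
      intro i hi
      rcases Finset.mem_insert.1 hi with rfl | hi
      · exact hx
      · exact Finset.mem_of_mem_erase (hC hi)) (by
      intro e he h1 h2
      by_cases e1 : e.1 = x
      · left; simp [e1]
      by_cases e2 : e.2 = x
      · right; simp [e2]
      rcases hcov e he (Finset.mem_erase.2 ⟨e1, h1⟩) (Finset.mem_erase.2 ⟨e2, h2⟩) with h | h
      · left; simp [h]
      · right; simp [h])
    have h2 := Finset.card_insert_le x C
    omega

theorem growth (E : Set (ι × ι)) (b a : ℕ) : ∀ (W : Finset ι) (Q : Set (ι →₀ ℕ)), W.card = a + b →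
    Adm E W a Q → ∀ d, Gr (SF b a) Q d := by
  classical
  induction a with
  | zero =>
    intro W Q hW hQ
    exact growth_free b W Q (by omega) hQ.lower hQ.supp
  | succ a ih =>
    obtain ⟨ht, hK⟩ := SF_all b a
    obtain ⟨hs, -⟩ := SF_all b (a + 1)
    have h : Step (SF b (a + 1)) (SF b a) (SF b a) := step_sq (SF b a)
    set t := SF b a
    set s := SF b (a + 1)
    intro W Q hW hQ
    obtain ⟨e, he, he1, he2⟩ : ∃ e ∈ E, e.1 ∈ W ∧ e.2 ∈ W := by
      by_contra hno
      push Not at hno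
      have := hQ.cov ∅ (by simp) (fun e he h1 h2 => (hno e he h1 h2).elim)
      simp at this
    have hL := hQ.lower
    -- the two pieces
    have A0 : ∀ x ∈ W, ∀ d, Gr t (del x Q) d := fun x hx =>
      ih (W.erase x) _ (by rw [Finset.card_erase_of_mem hx]; omega)
        (hQ.sub x hx (fun u hu => hu.1) (del_lower hL x) (fun u hu => hu.2))
    have hz : ∀ x y, Finsupp.single x 1 + Finsupp.single y 1 ∉ Q → ∀ u ∈ lnk x Q, u y = 0 := by
      intro x y hxy u hu
      by_contra hne
      apply hxy
      refine hL ?_ (show u + Finsupp.single x 1 ∈ Q from hu)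
      rw [add_comm]
      refine add_le_add_left ?_ _
      simpa [Finsupp.single_le_iff] using Nat.one_le_iff_ne_zero.2 hne
    have A1 : ∀ x ∈ W, ∀ y ∈ W, Finsupp.single x 1 + Finsupp.single y 1 ∉ Q →
        ∀ d, Gr t (lnk x Q) d := fun x hx y hy hxy =>
      ih (W.erase y) _ (by rw [Finset.card_erase_of_mem hy]; omega)
        (hQ.sub y hy (lnk_sub hL x) (lnk_lower hL x) (hz x y hxy))
    have key : ∀ d, ∀ x ∈ W, ∀ y ∈ W, Finsupp.single x 1 + Finsupp.single y 1 ∉ Q →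
        cnt (del y Q) d ≤ cnt (del x Q) d → Gr s Q d := by
      intro d x hx y hy hxy hle
      have hN := h.NS
      rcases d with _ | d
      · refine Gr_zero hs hL ?_
        have h1 := cnt_succ Q x 0
        have h2 := (A0 x hx 1).1
        have h3 := cnt_zero_le (lnk x Q)
        have h4 := h.NS 0
        have h5 := ht.N0
        simp only [Nat.zero_add] at *
        omega
      · obtain ⟨i1, i2⟩ := A1 x hx y hy hxy d
        obtain ⟨j1, j2⟩ := A0 x hx (d + 1)
        have c1 := cnt_succ Q x d
        have c2 := cnt_succ Q x (d + 1)
        have c3 : cnt (lnk x Q) (d + 1) ≤ cnt (del y Q) (d + 1) :=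
          cnt_mono (show lnk x Q ⊆ del y Q from fun u hu => ⟨lnk_sub hL x hu, hz x y hxy u hu⟩) (d + 1)
        have hN := h.NS d
        refine ⟨by omega, ?_⟩
        have k := hK d (cnt (del x Q) (d + 1)) j1 (cnt (lnk x Q) d) i1
        rw [c1, c2, h.GS]
        omega
    intro d
    have hxy := hQ.edge e he
    rcases le_total (cnt (del e.2 Q) d) (cnt (del e.1 Q) d) with hle | hle
    · exact key d e.1 he1 e.2 he2 hxy hle
    · exact key d e.2 he2 e.1 he1 (by rwa [add_comm]) hle

end

section
variable {ι : Type*} [DecidableEq ι]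

/-- initial segments of a monomial order, abstractly -/
structure LexS (s : Sys) (A V : Finset ι) (L : ℕ → ℕ → Finset (ι →₀ ℕ)) : Prop where
  card : ∀ d m, m ≤ s.N d → (L d m).card = m
  deg : ∀ d m, ∀ w ∈ L d m, w.degree = d
  supp : ∀ d m, ∀ w ∈ L d m, ∀ i ∉ V, w i = 0
  sq : ∀ d m, ∀ w ∈ L d m, ∀ i ∈ A, w i ≤ 1
  mono : ∀ d m m', m ≤ m' → L d m ⊆ L d m'
  full : ∀ d m, L d m ⊆ L d (s.N d)
  cl : ∀ d m, m ≤ s.N d → ∀ w i, w + Finsupp.single i 1 ∈ L (d + 1) (s.G d m) → w ∈ L d m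

def L0 (m : ℕ) : Finset (ι →₀ ℕ) := if m = 0 then ∅ else {0}

theorem lex_step {s t u : Sys} {A A' V : Finset ι} {L Lt Lu : ℕ → ℕ → Finset (ι →₀ ℕ)} {x : ι}
    (h : Step s t u) (ht : Good t) (hl : LexS t A V Lt) (hx : x ∉ V) (hA : A ⊆ V)
    (hz : ∀ m, L 0 m = L0 m)
    (hS : ∀ d m, L (d + 1) m = Lt (d + 1) (min m (t.N (d + 1))) ∪
      (Lu d (m - t.N (d + 1))).image (fun w => w + Finsupp.single x 1))
    (hu : (u = t ∧ Lu = Lt ∧ A' = insert x A) ∨ (u = s ∧ Lu = L ∧ A' = A)) :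
    LexS s A' (insert x V) L := by
  have hs : Good s := h.good ht (by rcases hu with h | h; exacts [Or.inl h.1, Or.inr h.1])
  have hug : Good u := by rcases hu with h | h <;> rw [h.1] <;> assumption
  have hinj : Function.Injective (fun u : ι →₀ ℕ => u + Finsupp.single x 1) :=
    fun a b h => add_right_cancel h
  have hxA : x ∉ A := fun h => hx (hA h)
  have hdisj : ∀ d m k, Disjoint (Lt (d + 1) m) ((Lu d k).image (fun w => w + Finsupp.single x 1)) := by
    intro d m k
    rw [Finset.disjoint_left]
    intro w hw hw2
    obtain ⟨w', _, rfl⟩ := Finset.mem_image.1 hw2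
    have := hl.supp _ _ _ hw x hx
    simp at this
  have hcard : ∀ d m, m ≤ s.N d → (L d m).card = m := by
    intro d
    induction d with
    | zero =>
      intro m hm
      rw [h.N0] at hm
      have : m = 0 ∨ m = 1 := by omega
      rcases this with rfl | rfl <;> simp [hz, L0]
    | succ d ih =>
      intro m hm
      have hN := h.NS d
      have : (Lu d (m - t.N (d + 1))).card = m - t.N (d + 1) := by
        rcases hu with ⟨h1, h2, _⟩ | ⟨h1, h2, _⟩
        · rw [h2]; exact hl.card _ _ (by rw [h1] at hN; omega)
        · rw [h2]; exact ih _ (by rw [h1] at hN; omega)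
      rw [hS, Finset.card_union_of_disjoint (hdisj _ _ _), Finset.card_image_of_injective _ hinj, this,
        hl.card _ _ (by omega)]
      omega
  have hdeg : ∀ d m, ∀ w ∈ L d m, w.degree = d := by
    intro d
    induction d with
    | zero =>
      intro m w hw
      rw [hz, L0] at hw
      split_ifs at hw
      · simp at hw
      · simp at hw; simp [hw]
    | succ d ih =>
      intro m w hw
      rw [hS, Finset.mem_union, Finset.mem_image] at hw
      rcases hw with hw | ⟨w', hw, rfl⟩
      · exact hl.deg _ _ _ hw
      · have : w'.degree = d := by
          rcases hu with ⟨_, h2, _⟩ | ⟨_, h2, _⟩ <;> rw [h2] at hw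
          · exact hl.deg _ _ _ hw
          · exact ih _ _ hw
        simp [this]
  have hsupp : ∀ d m, ∀ w ∈ L d m, ∀ i ∉ insert x V, w i = 0 := by
    intro d
    induction d with
    | zero =>
      intro m w hw
      rw [hz, L0] at hw
      split_ifs at hw
      · simp at hw
      · simp at hw; simp [hw]
    | succ d ih =>
      intro m w hw i hi
      have hi' : i ≠ x ∧ i ∉ V := by simpa using hi
      rw [hS, Finset.mem_union, Finset.mem_image] at hw
      rcases hw with hw | ⟨w', hw, rfl⟩
      · exact hl.supp _ _ _ hw i hi'.2
      · have : w' i = 0 := by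
          rcases hu with ⟨_, h2, _⟩ | ⟨_, h2, _⟩ <;> rw [h2] at hw
          · exact hl.supp _ _ _ hw i hi'.2
          · exact ih _ _ hw i hi
        simp [this, Finsupp.single_apply, hi'.1.symm]
  have hsq : ∀ d m, ∀ w ∈ L d m, ∀ i ∈ A', w i ≤ 1 := by
    intro d
    induction d with
    | zero =>
      intro m w hw
      rw [hz, L0] at hw
      split_ifs at hw
      · simp at hw
      · simp at hw; simp [hw]
    | succ d ih =>
      intro m w hw i hi
      have hi' : i = x ∨ i ∈ A := by
        rcases hu with ⟨_, _, h3⟩ | ⟨_, _, h3⟩ <;> rw [h3] at hi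
        · simpa using hi
        · exact Or.inr hi
      rw [hS, Finset.mem_union, Finset.mem_image] at hw
      rcases hw with hw | ⟨w', hw, rfl⟩
      · rcases hi' with rfl | hi'
        · rw [hl.supp _ _ _ hw i hx]; omega
        · exact hl.sq _ _ _ hw i hi'
      · rcases hu with ⟨_, h2, h3⟩ | ⟨_, h2, h3⟩ <;> rw [h2] at hw
        · rcases hi' with rfl | hi'
          · simp [hl.supp _ _ _ hw i hx]
          · have hne : x ≠ i := fun h => hxA (h ▸ hi')
            simpa [Finsupp.single_apply, hne] using hl.sq _ _ _ hw i hi'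
        · rw [h3] at hi
          have hne : x ≠ i := fun h => hxA (h ▸ hi)
          simpa [Finsupp.single_apply, hne] using ih _ _ hw i (h3 ▸ hi)
  have hmono : ∀ d m m', m ≤ m' → L d m ⊆ L d m' := by
    intro d
    induction d with
    | zero =>
      intro m m' hm
      rw [hz, hz]
      unfold L0
      split_ifs with h1 h2
      · simp
      · simp
      · omega
      · simp
    | succ d ih =>
      intro m m' hm
      rw [hS, hS]
      refine Finset.union_subset_union (hl.mono _ _ _ (by omega)) (Finset.image_subset_image ?_)
      rcases hu with ⟨_, h2, _⟩ | ⟨_, h2, _⟩ <;> rw [h2]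
      · exact hl.mono _ _ _ (by omega)
      · exact ih _ _ (by omega)
  have hfull : ∀ d m, L d m ⊆ L d (s.N d) := by
    intro d
    induction d with
    | zero =>
      intro m
      rw [hz, hz, h.N0]
      unfold L0
      split_ifs <;> simp_all
    | succ d ih =>
      intro m
      rw [hS, hS, h.NS]
      refine Finset.union_subset_union (hl.mono _ _ _ (by omega)) (Finset.image_subset_image ?_)
      rw [Nat.add_sub_cancel_left]
      rcases hu with ⟨h1, h2, _⟩ | ⟨h1, h2, _⟩ <;> rw [h1, h2]
      · exact hl.full _ _
      · exact ih _
  have hu0 : ∀ d, Lu d 0 = ∅ := by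
    intro d
    rw [← Finset.card_eq_zero]
    rcases hu with ⟨h1, h2, _⟩ | ⟨h1, h2, _⟩ <;> rw [h2]
    · exact hl.card _ _ (Nat.zero_le _)
    · exact hcard _ _ (Nat.zero_le _)
  have Llo : ∀ d m, m ≤ t.N (d + 1) → L (d + 1) m = Lt (d + 1) m := by
    intro d m hm
    rw [hS, min_eq_left hm, Nat.sub_eq_zero_of_le hm, hu0]; simp
  have Lhi : ∀ d k, L (d + 1) (t.N (d + 1) + k) = Lt (d + 1) (t.N (d + 1)) ∪
      (Lu d k).image (fun w => w + Finsupp.single x 1) := by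
    intro d k
    rw [hS, min_eq_right (by omega), Nat.add_sub_cancel_left]
  refine ⟨hcard, hdeg, hsupp, hsq, hmono, hfull, ?_⟩
  intro d
  induction d with
  | zero =>
    intro m hm w i hw
    rw [h.N0] at hm
    have hm : m = 0 ∨ m = 1 := by omega
    have hd := hdeg _ _ _ hw
    rcases hm with rfl | rfl
    · rw [hs.Gz, Llo 0 0 (Nat.zero_le _)] at hw
      have := hl.card (0 + 1) 0 (Nat.zero_le _)
      rw [Finset.card_eq_zero] at this
      rw [this] at hw
      simp at hw
    · have : w.degree = 0 := by
        rw [map_add, Finsupp.degree_single] at hd; omega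
      rw [hz, (Finsupp.degree_eq_zero_iff w).1 this]
      simp [L0]
  | succ d ih =>
    intro m hm w i hw
    have hN := h.NS d
    rcases le_total m (t.N (d + 1)) with hmt | hmt
    · have hle : t.G (d + 1) m ≤ t.N (d + 1 + 1) := by
        rw [← ht.GN]; exact ht.mono _ hmt
      rw [h.GS_le hug.Gz hmt, Llo _ _ hle] at hw
      rw [Llo _ _ hmt]
      exact hl.cl _ _ hmt w i hw
    · obtain ⟨k, rfl⟩ := Nat.exists_eq_add_of_le hmt
      have hk : k ≤ u.N d := by omega
      have ucl : ∀ w i, w + Finsupp.single i 1 ∈ Lu (d + 1) (u.G d k) → w ∈ Lu d k := by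
        rcases hu with ⟨h1, h2, _⟩ | ⟨h1, h2, _⟩
        · rw [h1] at hk ⊢
          rw [h2]; exact hl.cl d k hk
        · rw [h1] at hk ⊢
          rw [h2]; exact ih k hk
      rw [h.GS_add ht, Lhi, Finset.mem_union, Finset.mem_image] at hw
      rw [Lhi, Finset.mem_union, Finset.mem_image]
      rcases hw with hw | ⟨w', hw', hww⟩
      · left
        rw [← ht.GN] at hw
        exact hl.cl _ _ le_rfl w i hw
      · by_cases hix : i = x
        · subst hix
          obtain rfl : w' = w := hinj hww
          rcases hu with ⟨h1, h2, _⟩ | ⟨h1, h2, _⟩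
          · left
            rw [h2] at hw'
            exact hl.full _ _ hw'
          · have hw2 := hw'
            rw [h2, hS, Finset.mem_union, Finset.mem_image] at hw2
            rcases hw2 with hw2 | ⟨w2, hw2, rfl⟩
            · exact Or.inl (hl.full _ _ hw2)
            · exact Or.inr ⟨w2, ucl w2 i hw', rfl⟩
        · right
          have hwx : w x ≠ 0 := by
            have := DFunLike.congr_fun hww x
            simp [Finsupp.single_apply, hix] at this
            omega
          have e : w - Finsupp.single x 1 + Finsupp.single x 1 = w :=
            tsub_add_cancel_of_le (by simpa [Finsupp.single_le_iff] using Nat.one_le_iff_ne_zero.2 hwx)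
          refine ⟨w - Finsupp.single x 1, ucl _ i ?_, e⟩
          have : w - Finsupp.single x 1 + Finsupp.single i 1 = w' := by
            apply hinj
            change _ + _ + _ = w' + _
            rw [add_right_comm, e, hww]
          rwa [this]

theorem lex_nil : LexS nilS (∅ : Finset ι) ∅ (fun d m => if d = 0 then L0 m else ∅) := by
  have key : ∀ d m (w : ι →₀ ℕ), w ∈ (if d = 0 then L0 m else ∅ : Finset (ι →₀ ℕ)) → d = 0 ∧ m ≠ 0 ∧ w = 0 := by
    intro d m w hw
    unfold L0 at hw
    split_ifs at hw <;> simp_all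
  refine ⟨?_, ?_, ?_, ?_, ?_, ?_, ?_⟩
  · intro d m hm
    simp only [nilS] at hm
    split_ifs at hm with hd
    · have : m = 0 ∨ m = 1 := by omega
      rcases this with rfl | rfl <;> simp [hd, L0]
    · simp [hd]; omega
  · intro d m w hw
    obtain ⟨h1, h2, h3⟩ := key d m w hw
    simp [h1, h3]
  · intro d m w hw
    obtain ⟨h1, h2, h3⟩ := key d m w hw
    simp [h3]
  · intro d m w hw
    obtain ⟨h1, h2, h3⟩ := key d m w hw
    simp [h3]
  · intro d m m' hm w hw
    obtain ⟨h1, h2, h3⟩ := key d m w hw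
    have : m' ≠ 0 := by omega
    simp [h1, h3, L0, this]
  · intro d m w hw
    obtain ⟨h1, h2, h3⟩ := key d m w hw
    simp [h1, h3, L0, nilS]
  · intro d m hm w i hw
    exact absurd (key _ _ _ hw).1 (by omega)

noncomputable def frL (t : Sys) (Lt : ℕ → ℕ → Finset (ι →₀ ℕ)) (x : ι) : ℕ → ℕ → Finset (ι →₀ ℕ)
  | 0 => L0
  | d + 1 => fun m => Lt (d + 1) (min m (t.N (d + 1))) ∪
      (frL t Lt x d (m - t.N (d + 1))).image (fun w => w + Finsupp.single x 1)

noncomputable def sqL (t : Sys) (Lt : ℕ → ℕ → Finset (ι →₀ ℕ)) (x : ι) : ℕ → ℕ → Finset (ι →₀ ℕ)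
  | 0 => L0
  | d + 1 => fun m => Lt (d + 1) (min m (t.N (d + 1))) ∪
      (Lt d (m - t.N (d + 1))).image (fun w => w + Finsupp.single x 1)

theorem lex_fr (B : Finset ι) : ∃ L, LexS (FR B.card) ∅ B L := by
  induction B using Finset.induction_on with
  | empty => exact ⟨_, lex_nil⟩
  | insert x B hx ih =>
    obtain ⟨L, hL⟩ := ih
    rw [Finset.card_insert_of_notMem hx]
    exact ⟨frL (FR B.card) L x, lex_step (step_fr _) (FR_all _).1 hL hx (by simp) (fun _ => rfl)
      (fun _ _ => rfl) (Or.inr ⟨rfl, rfl, rfl⟩)⟩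

theorem lex_sf (B A : Finset ι) (hAB : Disjoint A B) : ∃ L, LexS (SF B.card A.card) A (A ∪ B) L := by
  induction A using Finset.induction_on with
  | empty =>
    obtain ⟨L, hL⟩ := lex_fr B
    exact ⟨L, by rw [Finset.empty_union]; exact hL⟩
  | insert x A hx ih =>
    rw [Finset.disjoint_insert_left] at hAB
    obtain ⟨L, hL⟩ := ih hAB.2
    rw [Finset.card_insert_of_notMem hx, Finset.insert_union]
    exact ⟨sqL (SF B.card A.card) L x, lex_step (step_sq _) (SF_all _ _).1 hL (by simp [hx, hAB.1])
      Finset.subset_union_left (fun _ => rfl) (fun _ _ => rfl) (Or.inl ⟨rfl, rfl, rfl⟩)⟩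

end

theorem lower_of_step {ι : Type*} {Q : Set (ι →₀ ℕ)}
    (h : ∀ w i, w + Finsupp.single i 1 ∈ Q → w ∈ Q) : IsLowerSet Q := by
  have key : ∀ k : ℕ, ∀ v m : ι →₀ ℕ, v.degree = k → m + v ∈ Q → m ∈ Q := by
    intro k
    induction k with
    | zero =>
      intro v m hv hm
      rw [(Finsupp.degree_eq_zero_iff v).1 hv, add_zero] at hm
      exact hm
    | succ k ih =>
      intro v m hv hm
      have hne : v ≠ 0 := by rintro rfl; simp at hv
      obtain ⟨i, hi⟩ := Finsupp.ne_iff.1 hne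
      have e : v - Finsupp.single i 1 + Finsupp.single i 1 = v :=
        tsub_add_cancel_of_le (by simpa [Finsupp.single_le_iff] using Nat.one_le_iff_ne_zero.2 hi)
      refine ih (v - Finsupp.single i 1) m ?_ (h _ i ?_)
      · have := congrArg Finsupp.degree e
        rw [map_add, Finsupp.degree_single] at this
        omega
      · rw [add_assoc, e]; exact hm
  intro u m hmu hu
  exact key _ (u - m) m rfl (by rwa [add_tsub_cancel_of_le hmu])

theorem stmt0 {K : Type*} [Field K] {n g : ℕ} (I : Ideal (MvPolynomial (Fin n) K))
    (hmon : IsQuadraticMonomialIdeal I) (hht : idealHeight I = (g : ℕ∞)) :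
    ∃ J : Ideal (MvPolynomial (Fin n) K), IsMonomialIdeal J ∧
      (∀ i : Fin n, (i : ℕ) < g → X i ^ 2 ∈ J) ∧
      (∀ d : ℕ, hilbertFunction K I d = hilbertFunction K J d) := by
  classical
  obtain ⟨E, rfl⟩ := hmon
  have hcov := cover_bound E hht
  let M : Set (Fin n →₀ ℕ) := (fun e : Fin n × Fin n => Finsupp.single e.1 1 + Finsupp.single e.2 1) '' E
  have hI : Ideal.span ((fun e : Fin n × Fin n => (X e.1 * X e.2 : MvPolynomial (Fin n) K)) '' E) =
      Ideal.span ((fun m => monomial m (1 : K)) '' M) := by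
    rw [Set.image_image]
    congr 1
    refine Set.image_congr fun e _ => ?_
    simp [X, monomial_mul]
  let Q : Set (Fin n →₀ ℕ) := {u | ∀ m ∈ M, ¬ m ≤ u}
  have hQ : Adm E Finset.univ g Q := by
    refine ⟨?_, ?_, ?_, ?_⟩
    · intro a b hab ha m hm hmb
      exact ha m hm (hmb.trans hab)
    · intro u _ i hi
      exact absurd (Finset.mem_univ i) hi
    · intro e he hmem
      exact hmem _ ⟨e, he, rfl⟩ le_rfl
    · intro C _ hC
      exact hcov C (fun e he => hC e he (Finset.mem_univ _) (Finset.mem_univ _))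
  have hgn : g ≤ n := by simpa using hcov Finset.univ (by simp)
  let A : Finset (Fin n) := Finset.univ.filter (fun i => (i : ℕ) < g)
  have hA : A.card = g := by
    simp only [A]
    rw [Fin.card_filter_val_lt]
    omega
  have hB : Aᶜ.card = n - g := by rw [Finset.card_compl, hA, Fintype.card_fin]
  obtain ⟨L, hL⟩ := lex_sf Aᶜ A disjoint_compl_right
  rw [hA, hB] at hL
  have hG := growth E (n - g) g Finset.univ Q (by simp; omega) hQ
  obtain ⟨hgood, -⟩ := SF_all (n - g) g
  set s := SF (n - g) g
  let R : Set (Fin n →₀ ℕ) := {w | w ∈ L w.degree (cnt Q w.degree)}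
  have hR : IsLowerSet R := by
    apply lower_of_step
    intro w i hw
    change _ ∈ L _ _ at hw
    rw [map_add, Finsupp.degree_single] at hw
    exact hL.cl _ _ (hG _).1 w i (hL.mono _ _ _ (hG _).2 hw)
  have hstd : ∀ u : Fin n →₀ ℕ, (∀ m ∈ Rᶜ, ¬ m ≤ u) ↔ u ∈ R := by
    intro u
    constructor
    · intro h
      by_contra hu
      exact h u hu le_rfl
    · intro hu m hm hmu
      exact hm (hR hmu hu)
  refine ⟨Ideal.span ((fun m => monomial m (1 : K)) '' Rᶜ), ⟨Rᶜ, rfl⟩, ?_, ?_⟩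
  · intro i hi
    refine Ideal.subset_span ⟨Finsupp.single i 2, ?_, ?_⟩
    · intro hmem
      have := hL.sq _ _ _ hmem i (by simp [A, hi])
      simp at this
    · simp [X_pow_eq_monomial]
  · intro d
    rw [hI, hilb_eq, hilb_eq]
    have e : {u : Fin n →₀ ℕ | (∀ m ∈ Rᶜ, ¬ m ≤ u) ∧ u.degree = d} = ↑(L d (cnt Q d)) := by
      ext u
      constructor
      · rintro ⟨h1, h2⟩
        have h3 : u ∈ L u.degree (cnt Q u.degree) := (hstd u).1 h1
        rw [h2] at h3
        exact h3
      · intro hu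
        have h2 := hL.deg _ _ _ hu
        refine ⟨(hstd u).2 ?_, h2⟩
        change u ∈ L u.degree (cnt Q u.degree)
        rw [h2]; exact hu
    rw [e, Set.ncard_coe_finset, hL.card _ _ (hG d).1]
    rfl
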